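/- Let Λ be a left and right Noetherian ring and M a finitely generated Λ-module with projective presentation P₁ →f P₀ → M → 0. Then there is an exact sequence 0 → Ext¹_{Λ^op}(Tr M, Λ) → M →σ M** → Ext²_{Λ^op}(Tr M, Λ) → 0, where σ is the canonical evaluation map. In particular, M is torsionless if and only if Ext¹_{Λ^op}(Tr M, Λ) = 0, and M is reflexive if and only if Ext^i_{Λ^op}(Tr M, Λ) = 0 for i = 1, 2. -/

import Mathlib

open CategoryTheory

universe u

noncomputable abbrev ExtGrp (Λ : Type u) [Ring Λ] (M N : ModuleCat.{u} Λ) (n : ℕ) :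
    Type u :=
  ((Ext ℤ (ModuleCat.{u} Λ) n).obj (Opposite.op M)).obj N

variable (Λ : Type u) [Ring Λ]

/-- The dual `f* : Q* → P*` of a map of left `Λ`-modules, as a map of right
(`Λᵐᵒᵖ`-) modules. -/
def dualMapOp {P Q : Type u} [AddCommGroup P] [Module Λ P] [AddCommGroup Q]
    [Module Λ Q] (f : P →ₗ[Λ] Q) : (Q →ₗ[Λ] Λ) →ₗ[Λᵐᵒᵖ] (P →ₗ[Λ] Λ) where
  toFun g := g.comp f
  map_add' g h := by ext x; simp
  map_smul' a g := by ext x; simp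

/-- The transpose of `M` (a right `Λ`-module) with respect to the finite free
presentation `f`. -/
abbrev TransposeOf (p q : ℕ) (f : (Fin p → Λ) →ₗ[Λ] (Fin q → Λ)) : Type u :=
  ((Fin p → Λ) →ₗ[Λ] Λ) ⧸ LinearMap.range (dualMapOp Λ f)

/-- The canonical evaluation map `σ : M → M** = Hom_{Λᵒᵖ}(Hom_Λ(M, Λ), Λ)`. -/
def sigmaEval (M : Type u) [AddCommGroup M] [Module Λ M] :
    M →ₗ[Λ] ((M →ₗ[Λ] Λ) →ₗ[Λᵐᵒᵖ] Λ) where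
  toFun x :=
    { toFun := fun g => g x
      map_add' := fun g h => rfl
      map_smul' := fun a g => rfl }
  map_add' x y := by ext g; simp
  map_smul' c x := by ext g; simp

namespace CategoryTheory.ProjectiveResolution

open Limits

variable {C : Type*} [Category* C] [Abelian C]

/-- The augmentation `P₀ ⟶ Z` of a projective resolution. -/
noncomputable def augmentation {Z : C} (P : ProjectiveResolution Z) : P.complex.X 0 ⟶ Z :=
  P.π.f 0

instance {Z : C} (P : ProjectiveResolution Z) : Epi P.augmentation :=
  inferInstanceAs (Epi (P.π.f 0))

theorem d_comp_augmentation {Z : C} (P : ProjectiveResolution Z) :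
    P.complex.d 1 0 ≫ P.augmentation = 0 :=
  P.complex_d_comp_π_f_zero

theorem d_comp_augmentation_comp {Z Y : C} (P : ProjectiveResolution Z) (h : Z ⟶ Y) :
    P.complex.d 1 0 ≫ P.augmentation ≫ h = 0 := by
  rw [← Category.assoc, P.d_comp_augmentation, zero_comp]

theorem exact_augmentation {Z : C} (P : ProjectiveResolution Z) :
    (ShortComplex.mk _ _ P.d_comp_augmentation).Exact :=
  P.exact₀

theorem exact_augmentation_comp {X Y : C} (P : ProjectiveResolution X) (i : X ⟶ Y) [Mono i] :
    (ShortComplex.mk (P.complex.d 1 0) (P.augmentation ≫ i)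
      (P.d_comp_augmentation_comp i)).Exact := by
  let α : ShortComplex.mk _ _ P.d_comp_augmentation ⟶
      ShortComplex.mk (P.complex.d 1 0) (P.augmentation ≫ i)
        (P.d_comp_augmentation_comp i) :=
    { τ₁ := 𝟙 _
      τ₂ := 𝟙 _
      τ₃ := i }
  have : Epi α.τ₁ := inferInstanceAs (Epi (𝟙 _))
  have : IsIso α.τ₂ := inferInstanceAs (IsIso (𝟙 _))
  have : Mono α.τ₃ := inferInstanceAs (Mono i)
  exact (ShortComplex.exact_iff_of_epi_of_isIso_of_mono α).1 P.exact_augmentation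

theorem exact_comp_of_shortExact {S : ShortComplex C} (hS : S.ShortExact)
    {X : C} (e : X ⟶ S.X₁) [Epi e] :
    (ShortComplex.mk (e ≫ S.f) S.g (by rw [Category.assoc, S.zero, comp_zero])).Exact := by
  let α : ShortComplex.mk (e ≫ S.f) S.g (by rw [Category.assoc, S.zero, comp_zero]) ⟶ S :=
    { τ₁ := e
      τ₂ := 𝟙 _
      τ₃ := 𝟙 _ }
  have : Epi α.τ₁ := inferInstanceAs (Epi e)
  have : IsIso α.τ₂ := inferInstanceAs (IsIso (𝟙 _))
  have : Mono α.τ₃ := inferInstanceAs (Mono (𝟙 _))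
  exact (ShortComplex.exact_iff_of_epi_of_isIso_of_mono α).2 hS.exact

/-- Splicing a projective resolution of `S.X₁` with a short exact sequence `S` with projective
middle term gives a projective resolution of `S.X₃`. -/
noncomputable def splice {S : ShortComplex C} (hS : S.ShortExact) (hP : Projective S.X₂)
    (P : ProjectiveResolution S.X₁) : ProjectiveResolution S.X₃ where
  complex := P.complex.augment (P.augmentation ≫ S.f) (P.d_comp_augmentation_comp S.f)
  projective n := match n with
    | 0 => hP
    | n + 1 => P.projective n
  π := (ChainComplex.toSingle₀Equiv _ _).symm ⟨S.g, by
    change (P.augmentation ≫ S.f) ≫ S.g = 0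
    rw [Category.assoc, S.zero, comp_zero]⟩
  quasiIso := ⟨fun n => by
    have := hS.mono_f
    have := hS.epi_g
    cases n with
    | zero =>
      rw [ChainComplex.quasiIsoAt₀_iff, ShortComplex.quasiIso_iff_of_zeros']
      · refine (ShortComplex.exact_and_epi_g_iff_of_iso ?_).2
          ⟨exact_comp_of_shortExact hS P.augmentation, this⟩
        refine ShortComplex.isoMk (Iso.refl _) (Iso.refl _) (Iso.refl _)
          ((Category.id_comp _).trans (Category.comp_id _).symm) ?_
        refine (Category.id_comp _).trans (Eq.trans ?_ (Category.comp_id _).symm)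
        exact (ChainComplex.toSingle₀Equiv_symm_apply_f_zero
          (C := P.complex.augment (P.augmentation ≫ S.f) _) (X := S.X₃) S.g _).symm
      all_goals rfl
    | succ n =>
      rw [quasiIsoAt_iff_exactAt' _ _ (ChainComplex.exactAt_succ_single_obj _ _),
        HomologicalComplex.exactAt_iff' _ (n + 1 + 1) (n + 1) n (by simp) (by simp)]
      cases n with
      | zero => exact P.exact_augmentation_comp S.f
      | succ n => exact P.exact_succ n⟩

theorem augmentation_splice {S : ShortComplex C} (hS : S.ShortExact) (hP : Projective S.X₂)
    (P : ProjectiveResolution S.X₁) : (P.splice hS hP).augmentation = S.g :=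
  ChainComplex.toSingle₀Equiv_symm_apply_f_zero
    (C := P.complex.augment (P.augmentation ≫ S.f) _) (X := S.X₃) S.g _

end CategoryTheory.ProjectiveResolution

theorem exists_surjective_cocycles_ext {R : Type u} [Ring R] {X : ModuleCat.{u} R}
    (P : ProjectiveResolution X) (Y : ModuleCat.{u} R) (n : ℕ) :
    ∃ ρ : LinearMap.ker (Linear.leftComp ℤ Y (P.complex.d (n + 2) (n + 1))) →+
        ExtGrp R X Y (n + 1),
      Function.Surjective ρ ∧ ∀ h, ρ h = 0 ↔ ∃ k, P.complex.d (n + 1) n ≫ k = h.1 := by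
  let K := P.complex.linearYonedaObj ℤ Y
  let T := K.sc' n (n + 1) (n + 2)
  let e : ((Ext ℤ (ModuleCat.{u} R) (n + 1)).obj (Opposite.op X)).obj Y ≅
      T.moduleCatLeftHomologyData.H :=
    P.isoExt (n + 1) Y ≪≫ K.homologyIsoSc' n (n + 1) (n + 2) (by simp) (by simp) ≪≫
      T.moduleCatHomologyIso
  let r : LinearMap.ker T.g.hom →ₗ[ℤ] _ := e.inv.hom.comp T.moduleCatLeftHomologyData.π.hom
  refine ⟨r.toAddMonoidHom, e.toLinearEquiv.symm.surjective.comp (Submodule.mkQ_surjective _),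
    fun h ↦ ?_⟩
  refine (e.toLinearEquiv.symm.map_eq_zero_iff (x := Submodule.mkQ _ h)).trans ?_
  refine (Submodule.Quotient.mk_eq_zero _).trans ?_
  constructor
  · rintro ⟨k, hk⟩
    exact ⟨k, congrArg Subtype.val hk⟩
  · rintro ⟨k, hk⟩
    exact ⟨k, Subtype.ext hk⟩

section Splice

variable {R : Type u} [Ring R] {A B K D N : ModuleCat.{u} R} {i : A ⟶ B} {p : B ⟶ K} {j : K ⟶ D}
  {r : D ⟶ N} {w : i ≫ p = 0} {w' : j ≫ r = 0}

theorem exists_surjective_ext_one (hS : (ShortComplex.mk i p w).ShortExact)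
    (hT : (ShortComplex.mk j r w').ShortExact) (hB : Projective B) (hD : Projective D)
    (Y : ModuleCat.{u} R) :
    ∃ ρ : LinearMap.ker (Linear.leftComp ℤ Y i) →+ ExtGrp R N Y 1,
      Function.Surjective ρ ∧ ∀ h, ρ h = 0 ↔ ∃ k, (p ≫ j) ≫ k = h.1 := by
  let P := ProjectiveResolution.of A
  let P₁ := P.splice hS hB
  let P₂ := P₁.splice hT hD
  obtain ⟨ρ, hρ, hρ'⟩ := exists_surjective_cocycles_ext P₂ Y 0
  have hd : P₂.complex.d 1 0 = p ≫ j := congrArg (· ≫ j) (P.augmentation_splice hS hB)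
  have mem (h : B ⟶ Y) : (P.augmentation ≫ i) ≫ h = 0 ↔ i ≫ h = 0 := by
    rw [Category.assoc, ← cancel_epi P.augmentation, Limits.comp_zero]
  let incl : LinearMap.ker (Linear.leftComp ℤ Y i) →+
      LinearMap.ker (Linear.leftComp ℤ Y (P₂.complex.d 2 1)) :=
    { toFun := fun h ↦ ⟨h.1, (mem h.1).2 h.2⟩
      map_zero' := rfl
      map_add' := fun _ _ ↦ rfl }
  refine ⟨ρ.comp incl, hρ.comp fun h ↦ ⟨⟨h.1, (mem h.1).1 h.2⟩, rfl⟩, fun h ↦ ?_⟩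
  refine (hρ' (incl h)).trans ?_
  change (∃ k, P₂.complex.d 1 0 ≫ k = h.1) ↔ _
  rw [hd]
  rfl

theorem exists_surjective_ext_two (hS : (ShortComplex.mk i p w).ShortExact)
    (hT : (ShortComplex.mk j r w').ShortExact) (hB : Projective B) (hD : Projective D)
    (Y : ModuleCat.{u} R) :
    ∃ ρ : (A ⟶ Y) →+ ExtGrp R N Y 2,
      Function.Surjective ρ ∧ ∀ h, ρ h = 0 ↔ ∃ k, i ≫ k = h := by
  let P := ProjectiveResolution.of A
  let P₁ := P.splice hS hB
  let P₂ := P₁.splice hT hD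
  obtain ⟨ρ, hρ, hρ'⟩ := exists_surjective_cocycles_ext P₂ Y 1
  let pre : (A ⟶ Y) →+ LinearMap.ker (Linear.leftComp ℤ Y (P₂.complex.d 3 2)) :=
    { toFun := fun h ↦ ⟨P.augmentation ≫ h, P.d_comp_augmentation_comp h⟩
      map_zero' := Subtype.ext Limits.comp_zero
      map_add' := fun _ _ ↦ Subtype.ext (Preadditive.comp_add _ _ _ _ _ _) }
  refine ⟨ρ.comp pre, hρ.comp fun h ↦ ?_, fun h ↦ ?_⟩
  · have hh : P.complex.d 1 0 ≫ h.1 = 0 := h.2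
    exact ⟨P.exact_augmentation.desc h.1 hh, Subtype.ext (P.exact_augmentation.g_desc h.1 hh)⟩
  · refine (hρ' (pre h)).trans ?_
    change (∃ k, (P.augmentation ≫ i) ≫ k = P.augmentation ≫ h) ↔ _
    simp only [Category.assoc, cancel_epi]

end Splice

section FiniteFree

variable (n : ℕ)

/-- The dual of a finite free left module is a finite free right module. -/
def dualPiEquiv : ((Fin n → Λ) →ₗ[Λ] Λ) ≃ₗ[Λᵐᵒᵖ] (Fin n → Λᵐᵒᵖ) where
  toFun h i := MulOpposite.op (h (Pi.single i 1))
  map_add' _ _ := rfl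
  map_smul' _ _ := rfl
  invFun v := ∑ i, v i • LinearMap.proj i
  left_inv h := LinearMap.pi_ext' fun i ↦ LinearMap.ext_ring (by simp [Pi.single_apply])
  right_inv v := by
    funext i
    simp [Pi.single_apply]

theorem projective_dual_pi :
    Projective (ModuleCat.of Λᵐᵒᵖ ((Fin n → Λ) →ₗ[Λ] Λ)) :=
  have := Module.Projective.of_equiv (dualPiEquiv Λ n).symm
  ModuleCat.projective_of_categoryTheory_projective _

theorem sigmaEval_pi_bijective : Function.Bijective (sigmaEval Λ (Fin n → Λ)) := by
  constructor
  · intro x y h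
    funext i
    exact DFunLike.congr_fun h (LinearMap.proj i)
  · intro φ
    refine ⟨fun i ↦ φ (LinearMap.proj i), ?_⟩
    have : (sigmaEval Λ _ fun i ↦ φ (LinearMap.proj i)) ∘ₗ (dualPiEquiv Λ n).symm.toLinearMap =
        φ ∘ₗ (dualPiEquiv Λ n).symm.toLinearMap := by
      ext v
      simp [dualPiEquiv, sigmaEval, Pi.single_apply]
    ext h
    simpa using DFunLike.congr_fun this (dualPiEquiv Λ n h)

end FiniteFree

section Dual

variable {Λ} {M P Q : Type u} [AddCommGroup M] [Module Λ M] [AddCommGroup P] [Module Λ P]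
  [AddCommGroup Q] [Module Λ Q]

theorem sigmaEval_naturality (f : P →ₗ[Λ] Q) (x : P) :
    sigmaEval Λ Q (f x) = sigmaEval Λ P x ∘ₗ dualMapOp Λ f :=
  rfl

theorem dualMapOp_injective {g : Q →ₗ[Λ] M} (hg : Function.Surjective g) :
    Function.Injective (dualMapOp Λ g) :=
  fun _ _ h ↦ (LinearMap.cancel_right hg).1 h

theorem dualMapOp_exact {f : P →ₗ[Λ] Q} {g : Q →ₗ[Λ] M} (hg : Function.Surjective g)
    (hexact : Function.Exact f g) : Function.Exact (dualMapOp Λ g) (dualMapOp Λ f) := by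
  intro h
  constructor
  · intro hh
    have hle : LinearMap.ker g ≤ LinearMap.ker h := by
      intro y hy
      obtain ⟨x, rfl⟩ := (hexact y).1 hy
      exact DFunLike.congr_fun hh x
    refine ⟨(LinearMap.ker g).liftQ h hle ∘ₗ (g.quotKerEquivOfSurjective hg).symm.toLinearMap, ?_⟩
    ext y
    have : (g.quotKerEquivOfSurjective hg).symm (g y) = (LinearMap.ker g).mkQ y :=
      (LinearEquiv.symm_apply_eq _).2 rfl
    simp [dualMapOp, this]
  · rintro ⟨k, rfl⟩
    ext x
    simp [dualMapOp, hexact.apply_apply_eq_zero]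

variable (Λ) in
/-- The exact sequence `0 → Ext¹(Tr M, Λ) → M → M** → Ext²(Tr M, Λ) → 0`. -/
theorem exists_transpose_exact_sequence (p q : ℕ) (f : (Fin p → Λ) →ₗ[Λ] (Fin q → Λ))
    (g : (Fin q → Λ) →ₗ[Λ] M) (hg : Function.Surjective g) (hexact : Function.Exact f g) :
    ∃ (ι : ExtGrp Λᵐᵒᵖ (ModuleCat.of Λᵐᵒᵖ (TransposeOf Λ p q f)) (ModuleCat.of Λᵐᵒᵖ Λ) 1 →+ M)
      (π : ((M →ₗ[Λ] Λ) →ₗ[Λᵐᵒᵖ] Λ) →+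
        ExtGrp Λᵐᵒᵖ (ModuleCat.of Λᵐᵒᵖ (TransposeOf Λ p q f)) (ModuleCat.of Λᵐᵒᵖ Λ) 2),
      Function.Injective ι ∧
      (∀ x : M, x ∈ Set.range ι ↔ sigmaEval Λ M x = 0) ∧
      Function.Surjective π ∧
      (∀ y : (M →ₗ[Λ] Λ) →ₗ[Λᵐᵒᵖ] Λ, π y = 0 ↔ y ∈ Set.range (sigmaEval Λ M)) := by
  let f' := dualMapOp Λ f
  have hS₀ : Function.Exact (dualMapOp Λ g) f'.rangeRestrict := fun h ↦ by
    rw [← dualMapOp_exact hg hexact h, Subtype.ext_iff]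
    rfl
  have hT₀ := LinearMap.exact_subtype_mkQ f'.range
  have hS : (ShortComplex.mk (ModuleCat.ofHom (dualMapOp Λ g))
      (ModuleCat.ofHom (Y := f'.range) f'.rangeRestrict)
      (ModuleCat.hom_ext hS₀.linearMap_comp_eq_zero)).ShortExact :=
    ModuleCat.shortComplex_shortExact _ hS₀ (dualMapOp_injective hg) f'.surjective_rangeRestrict
  have hT : (ShortComplex.mk (ModuleCat.ofHom (X := f'.range) f'.range.subtype)
      (ModuleCat.ofHom f'.range.mkQ)
      (ModuleCat.hom_ext hT₀.linearMap_comp_eq_zero)).ShortExact :=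
    ModuleCat.shortComplex_shortExact _ hT₀ f'.range.injective_subtype f'.range.mkQ_surjective
  obtain ⟨ρ₁, hρ₁, hρ₁'⟩ := exists_surjective_ext_one hS hT (projective_dual_pi Λ q)
    (projective_dual_pi Λ p) (ModuleCat.of Λᵐᵒᵖ Λ)
  obtain ⟨ρ₂, hρ₂, hρ₂'⟩ := exists_surjective_ext_two hS hT (projective_dual_pi Λ q)
    (projective_dual_pi Λ p) (ModuleCat.of Λᵐᵒᵖ Λ)
  let ev := LinearEquiv.ofBijective _ (sigmaEval_pi_bijective Λ q)
  let m : LinearMap.ker (Linear.leftComp ℤ (ModuleCat.of Λᵐᵒᵖ Λ)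
      (ModuleCat.ofHom (dualMapOp Λ g))) →+ M :=
    { toFun := fun h ↦ g (ev.symm h.1.hom)
      map_zero' := by simp
      map_add' := fun h h' ↦ by simp }
  have hm (h) : ρ₁ h = 0 ↔ m h = 0 := by
    refine (hρ₁' h).trans (Iff.trans ?_ (hexact _).symm)
    constructor
    · rintro ⟨k, hk⟩
      obtain ⟨x, hx⟩ := (sigmaEval_pi_bijective Λ p).2 k.hom
      refine ⟨x, (LinearEquiv.eq_symm_apply _).2 ?_⟩
      change sigmaEval Λ _ (f x) = _
      rw [sigmaEval_naturality, hx, ← hk]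
      rfl
    · rintro ⟨x, hx⟩
      refine ⟨ModuleCat.ofHom (sigmaEval Λ _ x), ModuleCat.hom_ext ?_⟩
      exact (LinearEquiv.eq_symm_apply ev).1 hx
  have hι (h) : ρ₁.liftOfSurjective hρ₁ ⟨m, fun h hh ↦ (hm h).1 hh⟩ (ρ₁ h) = m h :=
    AddMonoidHom.liftOfRightInverse_comp_apply _ _ _ _ h
  refine ⟨ρ₁.liftOfSurjective hρ₁ ⟨m, fun h hh ↦ (hm h).1 hh⟩,
    ρ₂.comp ⟨⟨ModuleCat.ofHom, rfl⟩, fun _ _ ↦ rfl⟩, ?_, fun x ↦ ?_,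
    hρ₂.comp fun h ↦ ⟨h.hom, rfl⟩, fun y ↦ ?_⟩
  · rw [injective_iff_map_eq_zero]
    intro a ha
    obtain ⟨h, rfl⟩ := hρ₁ a
    exact (hm h).2 ((hι h).symm.trans ha)
  · constructor
    · rintro ⟨a, rfl⟩
      obtain ⟨h, rfl⟩ := hρ₁ a
      rw [hι]
      change sigmaEval Λ M (g (ev.symm h.1.hom)) = 0
      have hev : sigmaEval Λ _ (ev.symm h.1.hom) = h.1.hom := ev.apply_symm_apply _
      rw [sigmaEval_naturality, hev]
      exact congrArg ModuleCat.Hom.hom h.2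
    · intro hx
      obtain ⟨y, rfl⟩ := hg x
      refine ⟨ρ₁ ⟨ModuleCat.ofHom (sigmaEval Λ _ y), ModuleCat.hom_ext hx⟩, (hι _).trans ?_⟩
      exact congrArg g (ev.symm_apply_apply y)
  · refine (hρ₂' (ModuleCat.ofHom y)).trans ?_
    constructor
    · rintro ⟨k, hk⟩
      obtain ⟨z, hz⟩ := (sigmaEval_pi_bijective Λ q).2 k.hom
      refine ⟨g z, ?_⟩
      rw [sigmaEval_naturality, hz]
      exact congrArg ModuleCat.Hom.hom hk
    · rintro ⟨x, rfl⟩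
      obtain ⟨z, rfl⟩ := hg x
      exact ⟨ModuleCat.ofHom (sigmaEval Λ _ z), rfl⟩

end Dual

theorem stmt14 [IsNoetherianRing Λ] [IsNoetherianRing Λᵐᵒᵖ]
    (M : Type u) [AddCommGroup M] [Module Λ M] [Module.Finite Λ M]
    (p q : ℕ) (f : (Fin p → Λ) →ₗ[Λ] (Fin q → Λ)) (g : (Fin q → Λ) →ₗ[Λ] M)
    (hg : Function.Surjective g) (hexact : LinearMap.range f = LinearMap.ker g) :
    (∃ (ι : ExtGrp Λᵐᵒᵖ (ModuleCat.of Λᵐᵒᵖ (TransposeOf Λ p q f))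
          (ModuleCat.of Λᵐᵒᵖ Λ) 1 →+ M)
      (π : ((M →ₗ[Λ] Λ) →ₗ[Λᵐᵒᵖ] Λ) →+
        ExtGrp Λᵐᵒᵖ (ModuleCat.of Λᵐᵒᵖ (TransposeOf Λ p q f))
          (ModuleCat.of Λᵐᵒᵖ Λ) 2),
      Function.Injective ι ∧
      (∀ x : M, x ∈ Set.range ι ↔ sigmaEval Λ M x = 0) ∧
      Function.Surjective π ∧
      (∀ y : (M →ₗ[Λ] Λ) →ₗ[Λᵐᵒᵖ] Λ, π y = 0 ↔ y ∈ Set.range (sigmaEval Λ M))) ∧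
    (Function.Injective (sigmaEval Λ M) ↔
      Subsingleton (ExtGrp Λᵐᵒᵖ (ModuleCat.of Λᵐᵒᵖ (TransposeOf Λ p q f))
        (ModuleCat.of Λᵐᵒᵖ Λ) 1)) ∧
    (Function.Bijective (sigmaEval Λ M) ↔
      (Subsingleton (ExtGrp Λᵐᵒᵖ (ModuleCat.of Λᵐᵒᵖ (TransposeOf Λ p q f))
        (ModuleCat.of Λᵐᵒᵖ Λ) 1) ∧
       Subsingleton (ExtGrp Λᵐᵒᵖ (ModuleCat.of Λᵐᵒᵖ (TransposeOf Λ p q f))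
        (ModuleCat.of Λᵐᵒᵖ Λ) 2))) := by
  obtain ⟨ι, π, hι, hι', hπ, hπ'⟩ := exists_transpose_exact_sequence Λ p q f g hg
    (LinearMap.exact_iff.2 hexact.symm)
  have inj_iff : Function.Injective (sigmaEval Λ M) ↔
      Subsingleton (ExtGrp Λᵐᵒᵖ (ModuleCat.of Λᵐᵒᵖ (TransposeOf Λ p q f))
        (ModuleCat.of Λᵐᵒᵖ Λ) 1) := by
    rw [injective_iff_map_eq_zero, subsingleton_iff_forall_eq 0]
    constructor
    · intro h a
      exact hι ((h _ ((hι' _).1 ⟨a, rfl⟩)).trans (map_zero ι).symm)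
    · intro h x hx
      obtain ⟨a, rfl⟩ := (hι' x).2 hx
      rw [h a, map_zero]
  have surj_iff : Function.Surjective (sigmaEval Λ M) ↔
      Subsingleton (ExtGrp Λᵐᵒᵖ (ModuleCat.of Λᵐᵒᵖ (TransposeOf Λ p q f))
        (ModuleCat.of Λᵐᵒᵖ Λ) 2) := by
    rw [subsingleton_iff_forall_eq 0, hπ.forall]
    exact forall_congr' fun y ↦ (hπ' y).symm
  exact ⟨⟨ι, π, hι, hι', hπ, hπ'⟩, inj_iff, and_congr inj_iff surj_iff⟩
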